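/- Define g : ℝ^p → ℝ by g(x) = max( f_φ(x) − ‖x‖₁/(1+p), 0 ), where ‖x‖₁ = Σ_{i=1}^p |x_i|. Then for every 3-CNF formula φ, g belongs to L²(ℝ^p) with respect to Lebesgue measure, i.e., ∫_{ℝ^p} g(x)² dx < ∞. -/

import Mathlib

open MeasureTheory

noncomputable def f0 (ε x : ℝ) : ℝ :=
  ε⁻¹ * (max 0 (x + ε) - 2 * max 0 x + max 0 (x - ε))

noncomputable def f1 (ε x : ℝ) : ℝ := f0 ε (x - 1)

/-- A literal over `p` Boolean variables: a variable index and a polarity. -/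
structure Lit (p : ℕ) where
  idx : Fin p
  pos : Bool

/-- Value of a literal on a real input: `f1` for a positive literal, `f0` for a negated one. -/
noncomputable def litVal (ε : ℝ) {p : ℕ} (L : Lit p) (x : Fin p → ℝ) : ℝ :=
  if L.pos then f1 ε (x L.idx) else f0 ε (x L.idx)

/-- Clause function `g_j(x) = Σ_{k=1}^{3} f0(ℓ₁(x) + ℓ₂(x) + ℓ₃(x) − k)`. -/
noncomputable def clauseVal (ε : ℝ) {p : ℕ} (C : Fin 3 → Lit p) (x : Fin p → ℝ) : ℝ :=
  ∑ k ∈ Finset.Icc (1 : ℕ) 3, f0 ε ((∑ t, litVal ε (C t) x) - (k : ℝ))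

/-- Formula function `f_φ(x) = f0(Σ_{j=1}^{c} g_j(x) − c)`. -/
noncomputable def cnfVal (ε : ℝ) {p c : ℕ} (φ : Fin c → Fin 3 → Lit p) (x : Fin p → ℝ) : ℝ :=
  f0 ε ((∑ j, clauseVal ε (φ j) x) - (c : ℝ))

/-- A Boolean assignment satisfies `φ` if every clause has a true literal. -/
def Satisfies {p c : ℕ} (a : Fin p → Bool) (φ : Fin c → Fin 3 → Lit p) : Prop :=
  ∀ j, ∃ t, a (φ j t).idx = (φ j t).pos

/-- Real embedding of a Boolean assignment. -/
noncomputable def embed {p : ℕ} (a : Fin p → Bool) : Fin p → ℝ :=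
  fun i => if a i then 1 else 0

theorem f0_le_one {ε : ℝ} (hε : 0 < ε) (x : ℝ) : f0 ε x ≤ 1 := by
  unfold f0
  rw [inv_mul_le_one₀ hε]
  rcases max_cases 0 (x + ε) with h₁ | h₁ <;> rcases max_cases 0 x with h₂ | h₂ <;>
    rcases max_cases 0 (x - ε) with h₃ | h₃ <;> linarith

theorem norm_le_sum_abs {ι : Type*} [Fintype ι] (x : ι → ℝ) : ‖x‖ ≤ ∑ i, |x i| :=
  (pi_norm_le_iff_of_nonneg (Finset.sum_nonneg fun i _ => abs_nonneg (x i))).2 fun i =>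
    Finset.single_le_sum (f := fun i => |x i|) (fun j _ => abs_nonneg (x j)) (Finset.mem_univ i)

theorem stmt10 (ε : ℝ) (hε : 0 < ε) (hε' : ε < 1 / 2)
    (p c : ℕ) (φ : Fin c → Fin 3 → Lit p) :
    ∫⁻ x : Fin p → ℝ,
        ENNReal.ofReal
          ((max (cnfVal ε φ x - (∑ i, |x i|) / (1 + (p : ℝ))) 0) ^ 2) < ⊤ := by
  have hp : (0 : ℝ) < 1 + p := by positivity
  calc
    _ ≤ ∫⁻ x, (Metric.closedBall (0 : Fin p → ℝ) (1 + p)).indicator 1 x := by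
      refine lintegral_mono fun x => ?_
      have hcnf : cnfVal ε φ x ≤ 1 := f0_le_one hε _
      have hsum : 0 ≤ ∑ i, |x i| := Finset.sum_nonneg fun i _ => abs_nonneg (x i)
      by_cases hx : x ∈ Metric.closedBall (0 : Fin p → ℝ) (1 + p)
      · rw [Set.indicator_of_mem hx, Pi.one_apply, ENNReal.ofReal_le_one]
        refine pow_le_one₀ (le_max_right _ _) (max_le ?_ zero_le_one)
        linarith [div_nonneg hsum hp.le]
      · rw [Set.indicator_of_notMem hx, max_eq_right, zero_pow two_ne_zero, ENNReal.ofReal_zero]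
        rw [mem_closedBall_zero_iff, not_le] at hx
        have hdiv : 1 ≤ (∑ i, |x i|) / (1 + (p : ℝ)) :=
          (one_le_div hp).2 (hx.le.trans (norm_le_sum_abs x))
        linarith
    _ = volume (Metric.closedBall (0 : Fin p → ℝ) (1 + p)) :=
      lintegral_indicator_one Metric.isClosed_closedBall.measurableSet
    _ < ⊤ := measure_closedBall_lt_top
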